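/- Let N ≥ 3, let X ⊆ ℝ^N be a domain (nonempty open connected set), let p > N/2, and let V : ℝ^N → ℝ be nonnegative and locally L^p-integrable on X. Let Ω ⊆ X be a domain admitting some smooth compactly supported function u₀ with support in Ω and ∫ V u₀² > 0, and assume 0 < μ_X < μ_Ω. Then there exists an open set B with compact closure contained in X such that Ω ∪ B is connected and μ_{Ω∪B} < μ_Ω; moreover, for every open set B with compact closure contained in X such that Ω ∪ B is connected and μ_{Ω∪B} < μ_Ω, every normalized minimizing sequence for μ_{Ω∪B} has a subsequence (u_{k_j}) whose gradients (∇u_{k_j}) form a Cauchy sequence in L²(ℝ^N; ℝ^N) (so the infimum μ_{Ω∪B} is attained in the completion D^{1,2}(Ω∪B)). -/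

import Mathlib

open MeasureTheory Filter Topology

/-- The Dirichlet energy `∫ |∇u|²` of a function on `ℝᴺ`. -/
noncomputable def grad2 (N : ℕ) (u : EuclideanSpace ℝ (Fin N) → ℝ) : ℝ :=
  ∫ x, ‖fderiv ℝ u x‖ ^ 2

/-- The weighted mass `∫ V u²`. -/
noncomputable def ven (N : ℕ) (V u : EuclideanSpace ℝ (Fin N) → ℝ) : ℝ :=
  ∫ x, V x * u x ^ 2

/-- A smooth test function with compact support contained in `Ω`. -/
def IsTest (N : ℕ) (Ω : Set (EuclideanSpace ℝ (Fin N)))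
    (u : EuclideanSpace ℝ (Fin N) → ℝ) : Prop :=
  ContDiff ℝ (⊤ : ℕ∞) u ∧ HasCompactSupport u ∧ tsupport u ⊆ Ω

/-- The Rayleigh quotient infimum `μ_Ω`. -/
noncomputable def mu (N : ℕ) (V : EuclideanSpace ℝ (Fin N) → ℝ)
    (Ω : Set (EuclideanSpace ℝ (Fin N))) : ℝ :=
  sInf {q : ℝ | ∃ u, IsTest N Ω u ∧ 0 < ven N V u ∧ q = grad2 N u / ven N V u}

/-- A normalized minimizing sequence for `μ_Ω`. -/
def MinimizingSeq (N : ℕ) (V : EuclideanSpace ℝ (Fin N) → ℝ)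
    (Ω : Set (EuclideanSpace ℝ (Fin N)))
    (u : ℕ → EuclideanSpace ℝ (Fin N) → ℝ) : Prop :=
  (∀ k, IsTest N Ω (u k)) ∧ (∀ k, ven N V (u k) = 1) ∧
    Tendsto (fun k => grad2 N (u k)) atTop (𝓝 (mu N V Ω))

/-- The gradients `∇u_k` form a Cauchy sequence in `L²(ℝᴺ; ℝᴺ)`. -/
def GradCauchy (N : ℕ) (u : ℕ → EuclideanSpace ℝ (Fin N) → ℝ) : Prop :=
  ∀ ε : ℝ, 0 < ε → ∃ M : ℕ, ∀ j ≥ M, ∀ l ≥ M,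
    (∫ x, ‖fderiv ℝ (u j) x - fderiv ℝ (u l) x‖ ^ 2) < ε

/-- `V` is locally `L^p` on `X`. -/
def LocLp (N : ℕ) (p : ℝ) (V : EuclideanSpace ℝ (Fin N) → ℝ)
    (X : Set (EuclideanSpace ℝ (Fin N))) : Prop :=
  ∀ K : Set (EuclideanSpace ℝ (Fin N)), IsCompact K → K ⊆ X →
    IntegrableOn (fun x => V x ^ p) K
/-! ### Test functions and the two quadratic forms -/

section TestFunctions

variable {N : ℕ} {X Ω W : Set (EuclideanSpace ℝ (Fin N))}
  {V u v : EuclideanSpace ℝ (Fin N) → ℝ} {p : ℝ}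

lemma IsTest.mono (hu : IsTest N Ω u) (h : Ω ⊆ W) : IsTest N W u :=
  ⟨hu.1, hu.2.1, hu.2.2.trans h⟩

lemma IsTest.add (hu : IsTest N Ω u) (hv : IsTest N Ω v) : IsTest N Ω (u + v) :=
  ⟨hu.1.add hv.1, hu.2.1.add hv.2.1,
    (tsupport_add u v).trans (Set.union_subset hu.2.2 hv.2.2)⟩

lemma IsTest.sub (hu : IsTest N Ω u) (hv : IsTest N Ω v) : IsTest N Ω (u - v) :=
  ⟨hu.1.sub hv.1, hu.2.1.sub hv.2.1,
    (tsupport_sub u v).trans (Set.union_subset hu.2.2 hv.2.2)⟩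

lemma IsTest.differentiable (hu : IsTest N Ω u) : Differentiable ℝ u :=
  hu.1.differentiable (by simp)

lemma IsTest.continuous (hu : IsTest N Ω u) : Continuous u := hu.1.continuous

lemma IsTest.continuous_fderiv (hu : IsTest N Ω u) : Continuous (fderiv ℝ u) :=
  hu.1.continuous_fderiv (by simp)

lemma IsTest.integrable_grad (hu : IsTest N Ω u) :
    Integrable (fun x => ‖fderiv ℝ u x‖ ^ 2) := by
  refine Continuous.integrable_of_hasCompactSupport (hu.continuous_fderiv.norm.pow 2) ?_
  exact (hu.2.1.fderiv ℝ).comp_left (g := fun L => ‖L‖ ^ 2) (by simp)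

lemma grad2_nonneg (u : EuclideanSpace ℝ (Fin N) → ℝ) : 0 ≤ grad2 N u :=
  integral_nonneg fun _ => by positivity

lemma ven_nonneg (hV : ∀ x, 0 ≤ V x) : 0 ≤ ven N V u :=
  integral_nonneg fun x => mul_nonneg (hV x) (sq_nonneg _)

lemma LocLp.aestronglyMeasurable (hp : 0 < p) (hV : ∀ x, 0 ≤ V x) (hVloc : LocLp N p V X)
    {K : Set (EuclideanSpace ℝ (Fin N))} (hK : IsCompact K) (hKX : K ⊆ X) :
    AEStronglyMeasurable V (volume.restrict K) := by
  have h := (hVloc K hK hKX).aestronglyMeasurable.aemeasurable.pow_const (1 / p)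
  refine (h.congr (ae_of_all _ fun x => ?_)).aestronglyMeasurable
  simp only
  rw [← Real.rpow_mul (hV x), mul_one_div_cancel hp.ne', Real.rpow_one]

lemma LocLp.integrableOn (hp : 1 ≤ p) (hV : ∀ x, 0 ≤ V x) (hVloc : LocLp N p V X)
    {K : Set (EuclideanSpace ℝ (Fin N))} (hK : IsCompact K) (hKX : K ⊆ X) :
    IntegrableOn V K := by
  have hfin : IntegrableOn (fun _ : EuclideanSpace ℝ (Fin N) => (1 : ℝ)) K := by
    simpa using hK.measure_lt_top
  refine Integrable.mono' (hfin.add (hVloc K hK hKX))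
    (hVloc.aestronglyMeasurable (by linarith) hV hK hKX) (ae_of_all _ fun x => ?_)
  rw [Real.norm_of_nonneg (hV x)]
  simp only [Pi.add_apply]
  rcases le_total (V x) 1 with h | h
  · have := Real.rpow_nonneg (hV x) p
    linarith
  · have := Real.rpow_le_rpow_of_exponent_le h hp
    rw [Real.rpow_one] at this
    linarith

lemma IsTest.integrable_ven (hp : 1 ≤ p) (hV : ∀ x, 0 ≤ V x) (hVloc : LocLp N p V X)
    (hu : IsTest N X u) : Integrable (fun x => V x * u x ^ 2) := by
  have hK : IsCompact (tsupport u) := hu.2.1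
  have h := (hVloc.integrableOn hp hV hK hu.2.2).mul_continuousOn
    (hu.continuous.pow 2).continuousOn hK
  refine (integrableOn_iff_integrable_of_support_subset fun x hx => ?_).1 h
  refine subset_tsupport u fun h0 => hx ?_
  simp [h0]

lemma norm_add_sq_add_norm_sub_sq (f g : EuclideanSpace ℝ (Fin N) →L[ℝ] ℝ) :
    ‖f + g‖ ^ 2 + ‖f - g‖ ^ 2 = 2 * ‖f‖ ^ 2 + 2 * ‖g‖ ^ 2 := by
  have h := parallelogram_law_with_norm ℝ ((InnerProductSpace.toDual ℝ _).symm f)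
    ((InnerProductSpace.toDual ℝ _).symm g)
  rw [← map_add, ← map_sub] at h
  simp only [LinearIsometryEquiv.norm_map] at h
  linarith

lemma grad2_add_add_grad2_sub (hu : IsTest N Ω u) (hv : IsTest N Ω v) :
    grad2 N (u + v) + grad2 N (u - v) = 2 * grad2 N u + 2 * grad2 N v := by
  unfold grad2
  rw [← integral_add (hu.add hv).integrable_grad (hu.sub hv).integrable_grad,
    ← integral_const_mul, ← integral_const_mul,
    ← integral_add (hu.integrable_grad.const_mul 2) (hv.integrable_grad.const_mul 2)]
  congr 1 with x
  rw [fderiv_add (hu.differentiable x) (hv.differentiable x),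
    fderiv_sub (hu.differentiable x) (hv.differentiable x), norm_add_sq_add_norm_sub_sq]

lemma ven_add_add_ven_sub (hp : 1 ≤ p) (hV : ∀ x, 0 ≤ V x) (hVloc : LocLp N p V X)
    (hu : IsTest N X u) (hv : IsTest N X v) :
    ven N V (u + v) + ven N V (u - v) = 2 * ven N V u + 2 * ven N V v := by
  have h := fun {w} (hw : IsTest N X w) => hw.integrable_ven hp hV hVloc
  unfold ven
  rw [← integral_add (h (hu.add hv)) (h (hu.sub hv)),
    ← integral_const_mul, ← integral_const_mul,
    ← integral_add ((h hu).const_mul 2) ((h hv).const_mul 2)]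
  congr 1 with x
  simp only [Pi.add_apply, Pi.sub_apply]
  ring

lemma bddBelow_rayleigh : BddBelow {q : ℝ | ∃ u, IsTest N Ω u ∧ 0 < ven N V u ∧
    q = grad2 N u / ven N V u} :=
  ⟨0, by rintro q ⟨u, -, hu, rfl⟩; exact div_nonneg (grad2_nonneg u) hu.le⟩

lemma mu_le (hu : IsTest N Ω u) (h : 0 < ven N V u) : mu N V Ω ≤ grad2 N u / ven N V u :=
  csInf_le bddBelow_rayleigh ⟨u, hu, h, rfl⟩

lemma mu_mul_ven_le (hV : ∀ x, 0 ≤ V x) (hu : IsTest N Ω u) :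
    mu N V Ω * ven N V u ≤ grad2 N u := by
  rcases (ven_nonneg hV : 0 ≤ ven N V u).eq_or_lt with h | h
  · rw [← h, mul_zero]
    exact grad2_nonneg u
  · exact (le_div_iff₀ h).1 (mu_le hu h)

lemma mu_anti (hne : ∃ u₀, IsTest N Ω u₀ ∧ 0 < ven N V u₀) (h : Ω ⊆ W) :
    mu N V W ≤ mu N V Ω := by
  obtain ⟨u, hu, hpos⟩ := hne
  refine csInf_le_csInf bddBelow_rayleigh ⟨_, u, hu, hpos, rfl⟩ ?_
  rintro q ⟨u, hu, hpos, rfl⟩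
  exact ⟨u, hu.mono h, hpos, rfl⟩

end TestFunctions

/-! ### Relatively compact connected neighbourhoods -/

lemma IsConnected.thickening {E : Type*} [NormedAddCommGroup E] [NormedSpace ℝ E]
    {s : Set E} (hs : IsConnected s) {δ : ℝ} (hδ : 0 < δ) :
    IsConnected (Metric.thickening δ s) := by
  obtain ⟨a, ha⟩ := hs.nonempty
  refine ⟨⟨a, Metric.self_subset_thickening hδ s ha⟩, ?_⟩
  refine isPreconnected_of_forall a fun y hy => ?_
  obtain ⟨z, hz, hyz⟩ := Metric.mem_thickening_iff.1 hy
  refine ⟨s ∪ Metric.ball z δ, Set.union_subset (Metric.self_subset_thickening hδ s)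
    (Metric.ball_subset_thickening hz δ), Or.inl ha, Or.inr (by simpa using hyz), ?_⟩
  exact hs.isPreconnected.union z hz (Metric.mem_ball_self hδ)
    (convex_ball z δ).isPreconnected

lemma exists_isOpen_isConnected_closure_subset {E : Type*} [NormedAddCommGroup E]
    [NormedSpace ℝ E] [ProperSpace E] {X K : Set E} (hX : IsOpen X) (hXc : IsConnected X)
    (hK : IsCompact K) (hKX : K ⊆ X) {a : E} (ha : a ∈ X) :
    ∃ B, IsOpen B ∧ IsConnected B ∧ IsCompact (closure B) ∧ closure B ⊆ X ∧ K ⊆ B ∧ a ∈ B := by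
  have key : ∀ x ∈ X, ∃ U, IsOpen U ∧ IsConnected U ∧ IsCompact (closure U) ∧ closure U ⊆ X ∧
      x ∈ U ∧ a ∈ U := by
    intro x hx
    obtain ⟨γ, hγ⟩ := (hX.isConnected_iff_isPathConnected.1 hXc).joinedIn a ha x hx
    have hPc : IsCompact (Set.range γ) := isCompact_range γ.continuous
    obtain ⟨δ, hδ, hδX⟩ := hPc.exists_cthickening_subset_open hX
      (Set.range_subset_iff.2 hγ)
    have hcl := Metric.closure_thickening_subset_cthickening δ (Set.range γ)
    refine ⟨Metric.thickening δ (Set.range γ), Metric.isOpen_thickening,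
      (isConnected_range γ.continuous).thickening hδ,
      hPc.cthickening.of_isClosed_subset isClosed_closure hcl, hcl.trans hδX,
      Metric.self_subset_thickening hδ _ ⟨1, γ.target⟩,
      Metric.self_subset_thickening hδ _ ⟨0, γ.source⟩⟩
  choose! U hUo hUc hUk hUX hxU haU using key
  obtain ⟨t, htK, hKt⟩ := (hK.insert a).elim_nhds_subcover U fun x hx =>
    (hUo x (Set.insert_subset ha hKX hx)).mem_nhds (hxU x (Set.insert_subset ha hKX hx))
  have htX : ∀ x ∈ t, x ∈ X := fun x hx => Set.insert_subset ha hKX (htK x hx)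
  have haB : a ∈ ⋃ x ∈ t, U x := hKt (Set.mem_insert _ _)
  have hclB : closure (⋃ x ∈ t, U x) = ⋃ x ∈ t, closure (U x) := t.closure_biUnion U
  refine ⟨⋃ x ∈ t, U x, isOpen_biUnion fun x hx => hUo x (htX x hx), ⟨⟨a, haB⟩, ?_⟩, ?_, ?_,
    (Set.subset_insert a K).trans hKt, haB⟩
  · refine isPreconnected_of_forall a fun y hy => ?_
    obtain ⟨x, hx, hyx⟩ := Set.mem_iUnion₂.1 hy
    exact ⟨U x, Set.subset_biUnion_of_mem (u := U) hx, haU x (htX x hx), hyx,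
      (hUc x (htX x hx)).isPreconnected⟩
  · rw [hclB]
    exact t.isCompact_biUnion fun x hx => hUk x (htX x hx)
  · rw [hclB]
    exact Set.iUnion₂_subset fun x hx => hUX x (htX x hx)

theorem exists_perturbation_mu_lt {N : ℕ} {X Ω : Set (EuclideanSpace ℝ (Fin N))}
    {V : EuclideanSpace ℝ (Fin N) → ℝ} (hXop : IsOpen X) (hXconn : IsConnected X)
    (hΩconn : IsConnected Ω) (hΩX : Ω ⊆ X) (hne : ∃ u₀, IsTest N Ω u₀ ∧ 0 < ven N V u₀)
    (hmuΩ : mu N V X < mu N V Ω) :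
    ∃ B : Set (EuclideanSpace ℝ (Fin N)), IsOpen B ∧ IsCompact (closure B) ∧
      closure B ⊆ X ∧ IsConnected (Ω ∪ B) ∧ mu N V (Ω ∪ B) < mu N V Ω := by
  obtain ⟨u₀, hu₀, h₀⟩ := hne
  obtain ⟨_, ⟨u, hu, hpos, rfl⟩, hlt⟩ :=
    exists_lt_of_csInf_lt (s := {q : ℝ | ∃ u, IsTest N X u ∧ 0 < ven N V u ∧
      q = grad2 N u / ven N V u}) ⟨_, u₀, hu₀.mono hΩX, h₀, rfl⟩ hmuΩ
  obtain ⟨a, ha⟩ := hΩconn.nonempty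
  obtain ⟨B, hBo, hBc, hBk, hBX, huB, haB⟩ :=
    exists_isOpen_isConnected_closure_subset hXop hXconn hu.2.1 hu.2.2 (hΩX ha)
  refine ⟨B, hBo, hBk, hBX, hΩconn.union ⟨a, ha, haB⟩ hBc, lt_of_le_of_lt ?_ hlt⟩
  exact mu_le ⟨hu.1, hu.2.1, huB.trans Set.subset_union_right⟩ hpos

/-! ### Weighted Sobolev inequality -/

section WeightedSobolev

variable {N : ℕ}

lemma IsTest.lintegral_grad {Ω : Set (EuclideanSpace ℝ (Fin N))}
    {u : EuclideanSpace ℝ (Fin N) → ℝ} (hu : IsTest N Ω u) :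
    ∫⁻ x, ‖fderiv ℝ u x‖ₑ ^ 2 = ENNReal.ofReal (grad2 N u) := by
  rw [grad2, ofReal_integral_eq_lintegral_ofReal hu.integrable_grad
    (ae_of_all _ fun x => by positivity)]
  refine lintegral_congr fun x => ?_
  rw [ENNReal.ofReal_pow (norm_nonneg _), ofReal_norm]

/-- The Hölder and Gagliardo–Nirenberg–Sobolev inequalities combined. -/
theorem exists_setIntegral_mul_sq_le (hN : 3 ≤ N) :
    ∃ C : ℝ, 0 < C ∧ ∀ (K : Set (EuclideanSpace ℝ (Fin N)))
      (g : EuclideanSpace ℝ (Fin N) → ℝ) (u : EuclideanSpace ℝ (Fin N) → ℝ),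
      (∀ x, 0 ≤ g x) → AEStronglyMeasurable g (volume.restrict K) →
      IntegrableOn (fun x => g x ^ ((N : ℝ) / 2)) K → IsTest N Set.univ u →
      ∫ x in K, g x * u x ^ 2 ≤
        C * (∫ x in K, g x ^ ((N : ℝ) / 2)) ^ (2 / (N : ℝ)) * grad2 N u := by
  have hN3 : (3 : ℝ) ≤ N := by exact_mod_cast hN
  set c := eLpNormLESNormFDerivOfEqInnerConst
    (volume : Measure (EuclideanSpace ℝ (Fin N))) ((2 : NNReal) : ℝ) with hc
  refine ⟨(c : ℝ) ^ 2 + 1, by positivity, fun K g u hg hgm hgi hu => ?_⟩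
  set q : NNReal := ⟨2 * N / (N - 2), by apply div_nonneg <;> linarith⟩ with hq
  have hqv : (q : ℝ) = 2 * N / (N - 2) := rfl
  have hq0 : (0 : ℝ) < q := by rw [hqv]; apply div_pos <;> linarith
  have hsob : eLpNorm u q volume ≤ c * eLpNorm (fderiv ℝ u) ((2 : NNReal) : ENNReal) volume := by
    refine eLpNorm_le_eLpNorm_fderiv_of_eq_inner volume (hu.1.of_le (by simp)) hu.2.1
      (by norm_num) (by rw [finrank_euclideanSpace_fin]; omega) ?_
    rw [finrank_euclideanSpace_fin, hqv]
    have : (N : ℝ) - 2 ≠ 0 := by linarith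
    push_cast
    field_simp
  rw [eLpNorm_nnreal_eq_lintegral (by exact_mod_cast hq0.ne'),
    eLpNorm_nnreal_eq_lintegral (by norm_num)] at hsob
  have hgrad : (∫⁻ x, ‖fderiv ℝ u x‖ₑ ^ ((2 : NNReal) : ℝ)) = ENNReal.ofReal (grad2 N u) := by
    rw [← hu.lintegral_grad]
    exact lintegral_congr fun x => by rw [NNReal.coe_ofNat, ENNReal.rpow_two]
  rw [hgrad] at hsob
  have hsob2 : (∫⁻ x, ‖u x‖ₑ ^ (q : ℝ)) ^ (2 / (q : ℝ)) ≤
      c ^ 2 * ENNReal.ofReal (grad2 N u) := by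
    have := ENNReal.rpow_le_rpow hsob (zero_le_two : (0 : ℝ) ≤ 2)
    rw [ENNReal.mul_rpow_of_nonneg _ _ zero_le_two, ← ENNReal.rpow_mul, ← ENNReal.rpow_mul] at this
    convert this using 2
    · ring
    · rw [ENNReal.rpow_two]
    · norm_num
  have hconj : ((N : ℝ) / 2).HolderConjugate ((q : ℝ) / 2) := by
    rw [Real.holderConjugate_iff]
    refine ⟨by linarith, ?_⟩
    rw [hqv]
    have : (N : ℝ) - 2 ≠ 0 := by linarith
    field_simp
    ring
  have hum : AEMeasurable (fun x => ‖u x‖ₑ ^ 2) (volume.restrict K) :=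
    (hu.continuous.enorm.measurable.pow_const 2).aemeasurable
  have hholder := ENNReal.lintegral_mul_le_Lp_mul_Lq (volume.restrict K) hconj
    (f := fun x => ENNReal.ofReal (g x)) hgm.aemeasurable.ennreal_ofReal hum
  have hA : ∫⁻ x in K, ENNReal.ofReal (g x) ^ ((N : ℝ) / 2) =
      ENNReal.ofReal (∫ x in K, g x ^ ((N : ℝ) / 2)) := by
    rw [ofReal_integral_eq_lintegral_ofReal hgi
      (ae_of_all _ fun x => Real.rpow_nonneg (hg x) _)]
    exact lintegral_congr fun x => ENNReal.ofReal_rpow_of_nonneg (hg x) (by positivity)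
  have hB : (∫⁻ x in K, (‖u x‖ₑ ^ 2) ^ ((q : ℝ) / 2)) ^ (1 / ((q : ℝ) / 2)) ≤
      c ^ 2 * ENNReal.ofReal (grad2 N u) := by
    refine le_trans ?_ hsob2
    rw [one_div_div]
    refine ENNReal.rpow_le_rpow ?_ (by positivity)
    refine (setLIntegral_le_lintegral _ _).trans (lintegral_mono fun x => ?_)
    rw [← ENNReal.rpow_natCast, ← ENNReal.rpow_mul]
    exact (congrArg _ (by push_cast; ring)).le
  have hI : 0 ≤ ∫ x in K, g x ^ ((N : ℝ) / 2) :=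
    integral_nonneg fun x => Real.rpow_nonneg (hg x) _
  have hD := grad2_nonneg u
  have hfin : ∫⁻ x in K, ENNReal.ofReal (g x * u x ^ 2) ≤ ENNReal.ofReal
      (((c : ℝ) ^ 2 + 1) * (∫ x in K, g x ^ ((N : ℝ) / 2)) ^ (2 / (N : ℝ)) * grad2 N u) := by
    calc ∫⁻ x in K, ENNReal.ofReal (g x * u x ^ 2)
        = ∫⁻ x in K, ((fun x => ENNReal.ofReal (g x)) * fun x => ‖u x‖ₑ ^ 2) x := by
          refine lintegral_congr fun x => ?_
          rw [ENNReal.ofReal_mul (hg x), Pi.mul_apply, ← sq_abs,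
            ENNReal.ofReal_pow (abs_nonneg _), ← Real.norm_eq_abs, ofReal_norm]
      _ ≤ _ := hholder
      _ ≤ ENNReal.ofReal ((∫ x in K, g x ^ ((N : ℝ) / 2)) ^ (2 / (N : ℝ))) *
          (c ^ 2 * ENNReal.ofReal (grad2 N u)) := by
          refine mul_le_mul' ?_ hB
          rw [hA, one_div_div, ENNReal.ofReal_rpow_of_nonneg hI (by positivity)]
      _ = ENNReal.ofReal ((∫ x in K, g x ^ ((N : ℝ) / 2)) ^ (2 / (N : ℝ)) *
          ((c : ℝ) ^ 2 * grad2 N u)) := by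
          rw [ENNReal.ofReal_mul (Real.rpow_nonneg hI _), ENNReal.ofReal_mul (by positivity),
            ENNReal.ofReal_pow c.coe_nonneg, ENNReal.ofReal_coe_nnreal]
      _ ≤ _ := by
          refine ENNReal.ofReal_le_ofReal ?_
          have := mul_nonneg (Real.rpow_nonneg hI (2 / (N : ℝ))) hD
          nlinarith
  rw [integral_eq_lintegral_of_nonneg_ae
    (ae_of_all _ fun x => mul_nonneg (hg x) (sq_nonneg _))
    (hgm.mul (hu.continuous.pow 2).aestronglyMeasurable)]
  exact ENNReal.toReal_le_of_le_ofReal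
    (mul_nonneg (mul_nonneg (by positivity) (Real.rpow_nonneg hI _)) hD) hfin

end WeightedSobolev

/-! ### Local compactness of the potential and coercivity -/

section Coercivity

variable {N : ℕ} {X Ω W K : Set (EuclideanSpace ℝ (Fin N))}
  {V : EuclideanSpace ℝ (Fin N) → ℝ} {p : ℝ}

lemma LocLp.exists_setIntegral_mul_sq_le (hN : 3 ≤ N) (hp : (N : ℝ) / 2 < p)
    (hV : ∀ x, 0 ≤ V x) (hVloc : LocLp N p V X) (hK : IsCompact K) (hKX : K ⊆ X)
    {η : ℝ} (hη : 0 < η) :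
    ∃ M : ℝ, 0 < M ∧ ∀ u, IsTest N X u →
      ∫ x in K, V x * u x ^ 2 ≤ M * (∫ x in K, u x ^ 2) + η * grad2 N u := by
  have hN3 : (3 : ℝ) ≤ N := by exact_mod_cast hN
  obtain ⟨C, hC, hCu⟩ := _root_.exists_setIntegral_mul_sq_le hN
  set A := ∫ x in K, V x ^ p with hA
  have hA0 : 0 ≤ A := integral_nonneg fun x => Real.rpow_nonneg (hV x) _
  have hlim : Tendsto (fun M : ℝ => C * (M ^ (-(p - N / 2)) * A) ^ (2 / (N : ℝ))) atTop (𝓝 0) := by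
    have h1 := (tendsto_rpow_neg_atTop (sub_pos.2 hp)).mul_const A
    rw [zero_mul] at h1
    have h2 := (h1.rpow_const (p := 2 / (N : ℝ)) (Or.inr (by positivity))).const_mul C
    rwa [Real.zero_rpow (by positivity), mul_zero] at h2
  obtain ⟨M, hMη, hM⟩ := ((hlim.eventually_lt_const hη).and (eventually_gt_atTop 0)).exists
  refine ⟨M, hM, fun u hu => ?_⟩
  set f : ℝ → ℝ := (Set.Ioi M).indicator id with hf
  have hfm : Measurable f := measurable_id.indicator measurableSet_Ioi
  have hf0 : ∀ t, 0 ≤ f t := Set.indicator_nonneg fun t ht => hM.le.trans (le_of_lt ht)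
  have hVm := hVloc.aestronglyMeasurable (by linarith) hV hK hKX
  have hgm : AEMeasurable (fun x => f (V x)) (volume.restrict K) :=
    hfm.comp_aemeasurable hVm.aemeasurable
  have hle : ∀ x, f (V x) ^ ((N : ℝ) / 2) ≤ M ^ (-(p - N / 2)) * V x ^ p := by
    intro x
    by_cases h : M < V x
    · rw [hf, Set.indicator_of_mem (Set.mem_Ioi.2 h), id]
      have hVx : 0 < V x := hM.trans h
      calc V x ^ ((N : ℝ) / 2) = V x ^ (-(p - N / 2)) * V x ^ p := by
            rw [← Real.rpow_add hVx]; congr 1; ring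
        _ ≤ _ := by
            refine mul_le_mul_of_nonneg_right ?_ (Real.rpow_nonneg (hV x) _)
            exact Real.rpow_le_rpow_of_nonpos hM h.le (by linarith)
    · rw [hf, Set.indicator_of_notMem (fun h' => h (Set.mem_Ioi.1 h')),
        Real.zero_rpow (by positivity)]
      exact mul_nonneg (Real.rpow_nonneg hM.le _) (Real.rpow_nonneg (hV x) _)
  have hdom : IntegrableOn (fun x => M ^ (-(p - N / 2)) * V x ^ p) K :=
    (hVloc K hK hKX).const_mul _
  have hgi : IntegrableOn (fun x => f (V x) ^ ((N : ℝ) / 2)) K := by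
    refine Integrable.mono' hdom (hgm.pow_const _).aestronglyMeasurable (ae_of_all _ fun x => ?_)
    rw [Real.norm_of_nonneg (Real.rpow_nonneg (hf0 _) _)]
    exact hle x
  have hgA : ∫ x in K, f (V x) ^ ((N : ℝ) / 2) ≤ M ^ (-(p - N / 2)) * A := by
    rw [hA, ← integral_const_mul]
    exact integral_mono hgi hdom hle
  have hsob := hCu K (fun x => f (V x)) u (fun x => hf0 _) hgm.aestronglyMeasurable hgi
    (hu.mono (Set.subset_univ _))
  have hu2 : IntegrableOn (fun x => u x ^ 2) K :=
    (hu.continuous.pow 2).continuousOn.integrableOn_compact hK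
  have hVu : IntegrableOn (fun x => V x * u x ^ 2) K :=
    (hu.integrable_ven (by linarith) hV hVloc).integrableOn
  have hgu : IntegrableOn (fun x => f (V x) * u x ^ 2) K := by
    refine Integrable.mono' hVu (hgm.aestronglyMeasurable.mul
      (hu.continuous.pow 2).aestronglyMeasurable) (ae_of_all _ fun x => ?_)
    rw [Real.norm_of_nonneg (mul_nonneg (hf0 _) (sq_nonneg _))]
    exact mul_le_mul_of_nonneg_right (Set.indicator_le_self' (fun _ _ => hV x) _) (sq_nonneg _)
  calc ∫ x in K, V x * u x ^ 2 ≤ ∫ x in K, (M * u x ^ 2 + f (V x) * u x ^ 2) := by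
        refine integral_mono hVu ((hu2.const_mul M).add hgu) fun x => ?_
        simp only
        rw [← add_mul]
        refine mul_le_mul_of_nonneg_right ?_ (sq_nonneg _)
        by_cases h : M < V x
        · rw [hf, Set.indicator_of_mem (Set.mem_Ioi.2 h), id]
          linarith
        · linarith [hf0 (V x), not_lt.1 h]
    _ = M * (∫ x in K, u x ^ 2) + ∫ x in K, f (V x) * u x ^ 2 := by
        rw [integral_add (hu2.const_mul M) hgu, integral_const_mul]
    _ ≤ _ := by
        refine add_le_add le_rfl (hsob.trans (mul_le_mul_of_nonneg_right (le_trans ?_ hMη.le)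
          (grad2_nonneg u)))
        refine mul_le_mul_of_nonneg_left (Real.rpow_le_rpow ?_ hgA (by positivity)) hC.le
        exact integral_nonneg fun x => Real.rpow_nonneg (hf0 _) _

/-- A smooth cut-off vanishing on a compact subset of `X`, equal to one away from a larger one. -/
lemma exists_cutoff (hX : IsOpen X) {F : Set (EuclideanSpace ℝ (Fin N))} (hF : IsCompact F)
    (hFX : F ⊆ X) :
    ∃ (K : Set (EuclideanSpace ℝ (Fin N))) (χ : EuclideanSpace ℝ (Fin N) → ℝ) (L : ℝ),
      IsCompact K ∧ K ⊆ X ∧ ContDiff ℝ (⊤ : ℕ∞) χ ∧ (∀ x ∈ F, χ x = 0) ∧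
      (∀ x ∉ K, χ x = 1) ∧ (∀ x, 0 ≤ χ x) ∧ (∀ x, χ x ≤ 1) ∧
      (∀ x ∉ K, fderiv ℝ χ x = 0) ∧ ∀ x, ‖fderiv ℝ χ x‖ ≤ L := by
  obtain ⟨K, hK, hFK, hKX⟩ := exists_compact_between hF hX hFX
  obtain ⟨f, hf0, hf1, hf⟩ := exists_contMDiffMap_zero_one_of_isClosed
    (modelWithCornersSelf ℝ (EuclideanSpace ℝ (Fin N))) (n := (⊤ : ℕ∞))
    hF.isClosed isOpen_interior.isClosed_compl
    (Set.disjoint_left.2 fun x hx hx' => hx' (hFK hx))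
  have hfs : ContDiff ℝ (⊤ : ℕ∞) f := f.contMDiff.contDiff
  have hfK : ∀ x ∉ K, f x = 1 := fun x hx => hf1 fun h => hx (interior_subset h)
  have hd : ∀ x ∉ K, fderiv ℝ f x = 0 := by
    intro x hx
    have : f =ᶠ[𝓝 x] fun _ => (1 : ℝ) := by
      filter_upwards [hK.isClosed.isOpen_compl.mem_nhds hx] with y hy using hfK y hy
    rw [this.fderiv_eq, fderiv_const_apply]
  obtain ⟨L, hL⟩ := hK.exists_bound_of_continuousOn
    (hfs.continuous_fderiv (by simp)).continuousOn
  refine ⟨K, f, max L 0, hK, hKX, hfs, fun x hx => hf0 hx, hfK, fun x => (hf x).1,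
    fun x => (hf x).2, hd, fun x => ?_⟩
  by_cases hx : x ∈ K
  · exact (hL x hx).trans (le_max_left _ _)
  · rw [hd x hx, norm_zero]
    exact le_max_right _ _

lemma add_sq_le_weighted {a b δ : ℝ} (hδ : 0 < δ) :
    (a + b) ^ 2 ≤ (1 + δ) * a ^ 2 + (1 + 1 / δ) * b ^ 2 := by
  have h : 0 ≤ (δ * a - b) ^ 2 / δ := by positivity
  have : (δ * a - b) ^ 2 / δ = δ * a ^ 2 - 2 * a * b + 1 / δ * b ^ 2 := by field_simp; ring
  nlinarith

lemma grad2_mul_le {χ u : EuclideanSpace ℝ (Fin N) → ℝ} {L δ : ℝ} (hK : IsCompact K)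
    (hχ : ContDiff ℝ (⊤ : ℕ∞) χ) (hχ0 : ∀ x, 0 ≤ χ x) (hχ1 : ∀ x, χ x ≤ 1)
    (hd : ∀ x ∉ K, fderiv ℝ χ x = 0) (hL : ∀ x, ‖fderiv ℝ χ x‖ ≤ L)
    (hu : IsTest N X u) (hχu : IsTest N W (χ * u)) (hδ : 0 < δ) :
    grad2 N (χ * u) ≤ (1 + δ) * grad2 N u + (1 + 1 / δ) * L ^ 2 * ∫ x in K, u x ^ 2 := by
  have hL0 : 0 ≤ L := (norm_nonneg _).trans (hL 0)
  have hu2 : IntegrableOn (fun x => u x ^ 2) K :=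
    (hu.continuous.pow 2).continuousOn.integrableOn_compact hK
  have hu2' : Integrable (K.indicator fun x => u x ^ 2) := hu2.integrable_indicator hK.measurableSet
  unfold grad2
  rw [← integral_indicator hK.measurableSet, ← integral_const_mul, ← integral_const_mul,
    ← integral_add (hu.integrable_grad.const_mul _) (hu2'.const_mul _)]
  refine integral_mono hχu.integrable_grad
    ((hu.integrable_grad.const_mul _).add (hu2'.const_mul _)) fun x => ?_
  have hfd : fderiv ℝ (χ * u) x = χ x • fderiv ℝ u x + u x • fderiv ℝ χ x :=
    fderiv_mul (hχ.differentiable (by simp) x) (hu.differentiable x)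
  have h1 : ‖χ x • fderiv ℝ u x‖ ≤ ‖fderiv ℝ u x‖ := by
    rw [norm_smul, Real.norm_of_nonneg (hχ0 x)]
    exact mul_le_of_le_one_left (norm_nonneg _) (hχ1 x)
  have h2 : ‖u x • fderiv ℝ χ x‖ ^ 2 ≤ L ^ 2 * K.indicator (fun x => u x ^ 2) x := by
    by_cases hx : x ∈ K
    · rw [Set.indicator_of_mem hx, norm_smul, mul_pow, Real.norm_eq_abs, sq_abs, mul_comm]
      exact mul_le_mul_of_nonneg_right (pow_le_pow_left₀ (norm_nonneg _) (hL x) 2) (sq_nonneg _)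
    · rw [Set.indicator_of_notMem hx, hd x hx]
      simp
  simp only
  rw [hfd]
  calc _ ≤ (‖fderiv ℝ u x‖ + ‖u x • fderiv ℝ χ x‖) ^ 2 :=
        pow_le_pow_left₀ (norm_nonneg _) ((norm_add_le _ _).trans (by gcongr)) 2
    _ ≤ _ := add_sq_le_weighted hδ
    _ ≤ _ := by
        rw [mul_assoc]
        gcongr

lemma ven_le_ven_mul_add {χ u : EuclideanSpace ℝ (Fin N) → ℝ} (hp : 1 ≤ p)
    (hV : ∀ x, 0 ≤ V x) (hVloc : LocLp N p V X) (hK : IsCompact K)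
    (hχ1 : ∀ x ∉ K, χ x = 1) (hu : IsTest N X u) (hχu : IsTest N X (χ * u)) :
    ven N V u ≤ ven N V (χ * u) + ∫ x in K, V x * u x ^ 2 := by
  have h1 := hu.integrable_ven hp hV hVloc
  have h2 := hχu.integrable_ven hp hV hVloc
  have h3 : Integrable (K.indicator fun x => V x * u x ^ 2) :=
    h1.integrableOn.integrable_indicator hK.measurableSet
  unfold ven
  rw [← integral_indicator hK.measurableSet, ← integral_add h2 h3]
  refine integral_mono h1 (h2.add h3) fun x => ?_
  simp only [Pi.mul_apply]
  by_cases hx : x ∈ K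
  · rw [Set.indicator_of_mem hx]
    exact le_add_of_nonneg_left (mul_nonneg (hV x) (sq_nonneg _))
  · rw [Set.indicator_of_notMem hx, hχ1 x hx]
    simp

/-- Below the threshold `μ_Ω`, the energy on `Ω ∪ B` is controlled by the defect
`∫ |∇u|² - μ ∫ V u²` and a local `L²` norm. -/
theorem exists_grad2_le (hN : 3 ≤ N) (hp : (N : ℝ) / 2 < p) (hX : IsOpen X)
    (hV : ∀ x, 0 ≤ V x) (hVloc : LocLp N p V X) (hΩX : Ω ⊆ X)
    {B : Set (EuclideanSpace ℝ (Fin N))} (hBk : IsCompact (closure B))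
    (hB : IsOpen B) (hBX : closure B ⊆ X)
    {μ : ℝ} (hμ0 : 0 < μ) (hμ : μ < mu N V Ω) :
    ∃ (K : Set (EuclideanSpace ℝ (Fin N))) (C : ℝ), IsCompact K ∧ 0 < C ∧
      ∀ u, IsTest N (Ω ∪ B) u →
        0 ≤ grad2 N u - μ * ven N V u →
        grad2 N u ≤ C * ((grad2 N u - μ * ven N V u) + ∫ x in K, u x ^ 2) := by
  have hN3 : (3 : ℝ) ≤ N := by exact_mod_cast hN
  have hp1 : 1 ≤ p := by linarith
  set m := mu N V Ω with hm
  have hm0 : 0 < m := hμ0.trans hμ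
  obtain ⟨K, χ, L, hK, hKX, hχ, hχF, hχK, hχ0, hχ1, hd, hL⟩ := exists_cutoff hX hBk hBX
  set d := m - μ with hdd
  have hd0 : 0 < d := sub_pos.2 hμ
  set δ := d / (4 * μ) with hδ
  have hδ0 : 0 < δ := by positivity
  set η := d / (4 * μ * m) with hη
  have hη0 : 0 < η := by positivity
  obtain ⟨M, hM, hMu⟩ := hVloc.exists_setIntegral_mul_sq_le hN hp hV hK hKX hη0
  set R := μ * ((1 + 1 / δ) * L ^ 2 + m * M) with hR
  have hR0 : 0 ≤ R := by positivity
  refine ⟨K, 2 * (m + R) / d, hK, by positivity, fun u hu hq => ?_⟩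
  have huX : IsTest N X u :=
    hu.mono (Set.union_subset hΩX (subset_closure.trans hBX))
  have hχu : IsTest N Ω (χ * u) := by
    refine ⟨hχ.mul hu.1, hu.2.1.mul_left, fun x hx => ?_⟩
    rcases hu.2.2 (tsupport_mul_subset_right hx) with h | h
    · exact h
    · exfalso
      have hsub : Function.support χ ⊆ Bᶜ := fun y hy hyB => hy (hχF y (subset_closure hyB))
      exact closure_minimal hsub hB.isClosed_compl (tsupport_mul_subset_left hx) h
  have e1 := grad2_mul_le hK hχ hχ0 hχ1 hd hL hu hχu hδ0
  have e2 := ven_le_ven_mul_add hp1 hV hVloc hK hχK huX (hχu.mono hΩX)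
  have e3 := mu_mul_ven_le hV hχu
  have e4 := hMu u huX
  rw [← hm] at e3
  set a := grad2 N u
  set b := ∫ x in K, u x ^ 2
  set v := ven N V u
  have hb : 0 ≤ b := integral_nonneg fun x => sq_nonneg _
  have e5 : m * v ≤ (1 + δ) * a + (1 + 1 / δ) * L ^ 2 * b + m * (M * b + η * a) := by
    nlinarith
  have e6 : m * (μ * v) ≤ μ * a + d / 2 * a + R * b := by
    have h := mul_le_mul_of_nonneg_left e5 hμ0.le
    have h1 : μ * δ = d / 4 := by rw [hδ]; field_simp
    have h2 : μ * m * η = d / 4 := by rw [hη]; field_simp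
    calc m * (μ * v) = μ * (m * v) := by ring
      _ ≤ _ := h
      _ = μ * a + (μ * δ + μ * m * η) * a + R * b := by rw [hR]; ring
      _ = _ := by rw [h1, h2]; ring
  have e7 : d / 2 * a ≤ m * (a - μ * v) + R * b := by
    have : d * a = m * a - μ * a := by rw [hdd]; ring
    nlinarith
  have e8 : m * (a - μ * v) + R * b ≤ (m + R) * ((a - μ * v) + b) := by
    nlinarith [mul_nonneg hm0.le hb, mul_nonneg hR0 hq]
  rw [div_mul_eq_mul_div, le_div_iff₀ hd0]
  linarith

end Coercivity

/-! ### A Rellich-type theorem -/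

section Rellich

variable {N : ℕ} {Ω K : Set (EuclideanSpace ℝ (Fin N))}

lemma sq_intervalIntegral_le {f : ℝ → ℝ} (hf : Continuous f) :
    (∫ t in (0 : ℝ)..1, f t) ^ 2 ≤ ∫ t in (0 : ℝ)..1, f t ^ 2 := by
  set c := ∫ t in (0 : ℝ)..1, f t with hc
  have h : 0 ≤ ∫ t in (0 : ℝ)..1, (f t - c) ^ 2 :=
    intervalIntegral.integral_nonneg zero_le_one fun t _ => sq_nonneg _
  have e : ∀ t, (f t - c) ^ 2 = f t ^ 2 - (2 * c * f t - c ^ 2) := fun t => by ring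
  simp_rw [e] at h
  rw [intervalIntegral.integral_sub (Continuous.intervalIntegrable (by fun_prop) _ _)
    (Continuous.intervalIntegrable (by fun_prop) _ _),
    intervalIntegral.integral_sub (Continuous.intervalIntegrable (by fun_prop) _ _)
    (by simp), intervalIntegral.integral_const_mul, ← hc] at h
  simp only [intervalIntegral.integral_const, sub_zero, one_smul] at h
  nlinarith

lemma IsTest.sq_translate_sub_le {u : EuclideanSpace ℝ (Fin N) → ℝ} (hu : IsTest N Ω u)
    (x y : EuclideanSpace ℝ (Fin N)) :
    (u (x + y) - u x) ^ 2 ≤ ∫ t in (0 : ℝ)..1, ‖y‖ ^ 2 * ‖fderiv ℝ u (x + t • y)‖ ^ 2 := by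
  have hline : Continuous fun t : ℝ => x + t • y := by fun_prop
  have hc : Continuous fun t : ℝ => fderiv ℝ u (x + t • y) y :=
    (hu.continuous_fderiv.comp hline).clm_apply continuous_const
  have hderiv : ∀ t : ℝ, HasDerivAt (fun t : ℝ => u (x + t • y)) (fderiv ℝ u (x + t • y) y) t := by
    intro t
    have h1 : HasDerivAt (fun t : ℝ => x + t • y) y t := by
      simpa using ((hasDerivAt_id t).smul_const y).const_add x
    exact (hu.differentiable _).hasFDerivAt.comp_hasDerivAt t h1
  have hftc := intervalIntegral.integral_eq_sub_of_hasDerivAt (a := 0) (b := 1)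
    (fun t _ => hderiv t) (hc.intervalIntegrable _ _)
  simp only [one_smul, zero_smul, add_zero] at hftc
  rw [← hftc]
  refine (sq_intervalIntegral_le hc).trans ?_
  refine intervalIntegral.integral_mono_on zero_le_one ((hc.pow 2).intervalIntegrable _ _)
    (Continuous.intervalIntegrable
      (continuous_const.mul ((hu.continuous_fderiv.comp hline).norm.pow 2)) _ _) fun t _ => ?_
  rw [← mul_pow, ← sq_abs, ← Real.norm_eq_abs, mul_comm]
  exact pow_le_pow_left₀ (norm_nonneg _) (ContinuousLinearMap.le_opNorm _ _) 2

lemma IsTest.integrable_sq_translate_sub {u : EuclideanSpace ℝ (Fin N) → ℝ} (hu : IsTest N Ω u)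
    (y : EuclideanSpace ℝ (Fin N)) : Integrable fun x => (u (x + y) - u x) ^ 2 := by
  have h1 : HasCompactSupport fun x => u (x + y) :=
    hu.2.1.comp_homeomorph (Homeomorph.addRight y)
  refine Continuous.integrable_of_hasCompactSupport
    (((hu.continuous.comp (continuous_add_const y)).sub hu.continuous).pow 2) ?_
  exact (h1.sub hu.2.1).comp_left (g := fun t : ℝ => t ^ 2) (by simp)

lemma IsTest.integral_sq_translate_sub_le {u : EuclideanSpace ℝ (Fin N) → ℝ} (hu : IsTest N Ω u)
    (y : EuclideanSpace ℝ (Fin N)) :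
    ∫ x, (u (x + y) - u x) ^ 2 ≤ ‖y‖ ^ 2 * grad2 N u := by
  have hnn : 0 ≤ ‖y‖ ^ 2 * grad2 N u := mul_nonneg (sq_nonneg _) (grad2_nonneg u)
  rw [integral_eq_lintegral_of_nonneg_ae (ae_of_all _ fun x => sq_nonneg _)
    (hu.integrable_sq_translate_sub y).aestronglyMeasurable]
  refine ENNReal.toReal_le_of_le_ofReal hnn ?_
  have hcont : Continuous fun z : EuclideanSpace ℝ (Fin N) × ℝ =>
      ‖y‖ ^ 2 * ‖fderiv ℝ u (z.1 + z.2 • y)‖ ^ 2 :=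
    continuous_const.mul ((hu.continuous_fderiv.comp (by fun_prop)).norm.pow 2)
  calc ∫⁻ x, ENNReal.ofReal ((u (x + y) - u x) ^ 2)
      ≤ ∫⁻ x, ∫⁻ t in Set.Ioc (0 : ℝ) 1,
          ENNReal.ofReal (‖y‖ ^ 2 * ‖fderiv ℝ u (x + t • y)‖ ^ 2) := by
        refine lintegral_mono fun x => ?_
        have hc : Continuous fun t : ℝ => ‖y‖ ^ 2 * ‖fderiv ℝ u (x + t • y)‖ ^ 2 :=
          continuous_const.mul ((hu.continuous_fderiv.comp (by fun_prop)).norm.pow 2)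
        rw [← ofReal_integral_eq_lintegral_ofReal
          ((intervalIntegrable_iff_integrableOn_Ioc_of_le zero_le_one).1
            (hc.intervalIntegrable 0 1)) (ae_of_all _ fun t => by positivity),
          ← intervalIntegral.integral_of_le zero_le_one]
        exact ENNReal.ofReal_le_ofReal (hu.sq_translate_sub_le x y)
    _ = ∫⁻ t in Set.Ioc (0 : ℝ) 1, ∫⁻ x,
          ENNReal.ofReal (‖y‖ ^ 2 * ‖fderiv ℝ u (x + t • y)‖ ^ 2) :=
        lintegral_lintegral_swap hcont.measurable.ennreal_ofReal.aemeasurable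
    _ = ∫⁻ _t in Set.Ioc (0 : ℝ) 1, ENNReal.ofReal (‖y‖ ^ 2 * grad2 N u) := by
        refine lintegral_congr fun t => ?_
        rw [lintegral_add_right_eq_self
          (fun x => ENNReal.ofReal (‖y‖ ^ 2 * ‖fderiv ℝ u x‖ ^ 2)) (t • y),
          ← ofReal_integral_eq_lintegral_ofReal (hu.integrable_grad.const_mul _)
            (ae_of_all _ fun t => by positivity), integral_const_mul, grad2]
    _ = _ := by simp

/-- Approximation in `L²(K)` by averages over balls of radius `r`. -/
lemma IsTest.setIntegral_sq_le {u : EuclideanSpace ℝ (Fin N) → ℝ} (hu : IsTest N Ω u)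
    (hK : IsCompact K) {r : ℝ} (hr : 0 < r) :
    ∫ x in K, u x ^ 2 ≤ 2 * r ^ 2 * grad2 N u +
      4 / (volume.real (Metric.closedBall (0 : EuclideanSpace ℝ (Fin N)) r)) ^ 2 *
        ∫ x in K, (∫ y in Metric.closedBall 0 r, u (x + y)) ^ 2 := by
  set B := Metric.closedBall (0 : EuclideanSpace ℝ (Fin N)) r with hB
  have hBc : IsCompact B := isCompact_closedBall _ _
  have hBm : MeasurableSet B := hBc.measurableSet
  set b := volume.real B with hb
  have hb0 : 0 < b := ENNReal.toReal_pos
    (Metric.measure_closedBall_pos volume _ hr).ne' hBc.measure_lt_top.ne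
  set S := fun x => ∫ y in B, u (x + y) with hS
  have hcu := hu.continuous
  have hScont : Continuous S := continuous_parametric_integral_of_continuous
    (by fun_prop : Continuous fun z : EuclideanSpace ℝ (Fin N) × EuclideanSpace ℝ (Fin N) =>
      u (z.1 + z.2)) hBc
  have hTcont : Continuous fun x => ∫ y in B, (u (x + y) - u x) ^ 2 :=
    continuous_parametric_integral_of_continuous
      (by fun_prop : Continuous fun z : EuclideanSpace ℝ (Fin N) × EuclideanSpace ℝ (Fin N) =>
        (u (z.1 + z.2) - u z.1) ^ 2) hBc
  have hint : ∀ {f : EuclideanSpace ℝ (Fin N) → ℝ} {s : Set (EuclideanSpace ℝ (Fin N))},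
      Continuous f → IsCompact s → IntegrableOn f s :=
    fun hf hs => hf.continuousOn.integrableOn_compact hs
  have hpt : ∀ x, u x ^ 2 ≤ 2 / b * (∫ y in B, (u (x + y) - u x) ^ 2) + 4 / b ^ 2 * S x ^ 2 := by
    intro x
    have h1 : b * u x ^ 2 ≤ (∫ y in B, (u (x + y) - u x) ^ 2) + 2 * u x * S x := by
      calc b * u x ^ 2 = ∫ _y in B, u x ^ 2 := by simp [hb]
        _ ≤ ∫ y in B, ((u (x + y) - u x) ^ 2 + 2 * u x * u (x + y)) := by
            refine integral_mono (hint (by fun_prop) hBc) (hint (by fun_prop) hBc) fun y => ?_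
            simp only
            nlinarith [sq_nonneg (u (x + y))]
        _ = _ := by
            rw [integral_add (hint (by fun_prop) hBc) (hint (by fun_prop) hBc),
              integral_const_mul]
    have h2 : 0 ≤ (b * u x - 2 * S x) ^ 2 := sq_nonneg _
    set T := ∫ y in B, (u (x + y) - u x) ^ 2
    have h3 : b ^ 2 * u x ^ 2 ≤ 2 * b * T + 4 * S x ^ 2 := by nlinarith
    have h4 : 2 / b * T + 4 / b ^ 2 * S x ^ 2 = (2 * b * T + 4 * S x ^ 2) / b ^ 2 := by
      field_simp
    rw [h4, le_div_iff₀ (by positivity)]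
    linarith
  have hswap : ∫ x in K, ∫ y in B, (u (x + y) - u x) ^ 2 ≤ b * (r ^ 2 * grad2 N u) := by
    have hprod : Integrable (Function.uncurry fun x y => (u (x + y) - u x) ^ 2)
        ((volume.restrict K).prod (volume.restrict B)) := by
      rw [Measure.prod_restrict]
      refine ContinuousOn.integrableOn_compact (hK.prod hBc) (Continuous.continuousOn ?_)
      unfold Function.uncurry
      fun_prop
    rw [integral_integral_swap hprod]
    calc ∫ y in B, ∫ x in K, (u (x + y) - u x) ^ 2 ≤ ∫ _y in B, r ^ 2 * grad2 N u := by
          refine setIntegral_mono_on hprod.integral_prod_right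
            (integrable_const_iff.2 (Or.inr ?_)) hBm fun y hy => ?_
          · exact ⟨by simpa using hBc.measure_lt_top⟩
          · refine (setIntegral_le_integral (hu.integrable_sq_translate_sub y)
              (ae_of_all _ fun x => sq_nonneg _)).trans
              ((hu.integral_sq_translate_sub_le y).trans ?_)
            exact mul_le_mul_of_nonneg_right
              (pow_le_pow_left₀ (norm_nonneg _) (by simpa [hB] using hy) 2) (grad2_nonneg u)
      _ = _ := by simp [hb]
  calc ∫ x in K, u x ^ 2
      ≤ ∫ x in K, (2 / b * (∫ y in B, (u (x + y) - u x) ^ 2) + 4 / b ^ 2 * S x ^ 2) :=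
        integral_mono (hint (by fun_prop) hK) (hint (by fun_prop) hK) hpt
    _ = 2 / b * (∫ x in K, ∫ y in B, (u (x + y) - u x) ^ 2) +
          4 / b ^ 2 * ∫ x in K, S x ^ 2 := by
        rw [integral_add (hint (by fun_prop) hK) (hint (by fun_prop) hK), integral_const_mul,
          integral_const_mul]
    _ ≤ 2 / b * (b * (r ^ 2 * grad2 N u)) + 4 / b ^ 2 * ∫ x in K, S x ^ 2 := by gcongr
    _ = _ := by
        have : 2 / b * (b * (r ^ 2 * grad2 N u)) = 2 * r ^ 2 * grad2 N u := by field_simp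
        rw [this]

/-- Bounded sequences in `L²(K)` have subsequences whose integrals over sets converge. -/
lemma exists_subseq_tendsto_setIntegral (hK : IsCompact K)
    {u : ℕ → EuclideanSpace ℝ (Fin N) → ℝ} (hu : ∀ k, Continuous (u k)) {A : ℝ}
    (hA : ∀ k, ∫ x in K, u k x ^ 2 ≤ A) :
    ∃ φ : ℕ → ℕ, StrictMono φ ∧ ∀ s ⊆ K, MeasurableSet s →
      ∃ c, Tendsto (fun k => ∫ x in s, u (φ k) x) atTop (𝓝 c) := by
  set m := (volume : Measure (EuclideanSpace ℝ (Fin N))).restrict K with hm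
  have hfin : IsFiniteMeasure m := ⟨by simpa [hm] using hK.measure_lt_top⟩
  have hint : ∀ k, Integrable (fun x => u k x ^ 2) m := fun k =>
    ((hu k).pow 2).continuousOn.integrableOn_compact hK
  have hmem : ∀ k, MemLp (u k) 2 m := fun k =>
    (memLp_two_iff_integrable_sq (hu k).aestronglyMeasurable).2 (hint k)
  set f : ℕ → Lp ℝ 2 m := fun k => (hmem k).toLp (u k) with hf
  have hnorm : ∀ k, ‖f k‖ ≤ Real.sqrt A := by
    intro k
    refine Real.le_sqrt_of_sq_le (le_trans (le_of_eq ?_) (hA k))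
    rw [← real_inner_self_eq_norm_sq, L2.inner_def]
    refine integral_congr_ae ?_
    filter_upwards [(hmem k).coeFn_toLp] with x hx
    simp only [hf, hx, real_inner_self_eq_norm_sq, Real.norm_eq_abs, sq_abs]
  have htop : Fact ((2 : ENNReal) ≠ ⊤) := ⟨ENNReal.ofNat_ne_top⟩
  have hsep : TopologicalSpace.SeparableSpace (Lp ℝ 2 m) := inferInstance
  obtain ⟨T, -, φ, hφ, hT⟩ := WeakDual.isSeqCompact_closedBall ℝ (Lp ℝ 2 m) 0 (Real.sqrt A)
    (x := fun k => StrongDual.toWeakDual (InnerProductSpace.toDual ℝ (Lp ℝ 2 m) (f k)))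
    (fun k => by
      simp only [Set.mem_preimage, mem_closedBall_zero_iff]
      exact ((InnerProductSpace.toDual ℝ (Lp ℝ 2 m)).norm_map (f k)).trans_le (hnorm k))
  refine ⟨φ, hφ, fun s hs hsm => ?_⟩
  set g := indicatorConstLp (μ := m) 2 hsm (measure_ne_top m s) (1 : ℝ) with hg
  refine ⟨T g, ?_⟩
  have h := ((WeakDual.eval_continuous g).tendsto T).comp hT
  refine h.congr fun k => ?_
  change inner ℝ (f (φ k)) g = _
  rw [real_inner_comm, hg, L2.inner_indicatorConstLp_one]
  rw [integral_congr_ae (ae_restrict_of_ae (hmem (φ k)).coeFn_toLp), hm,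
    Measure.restrict_restrict hsm, Set.inter_eq_self_of_subset_left hs]

/-- A bounded sequence of test functions in the Dirichlet norm has a subsequence that is Cauchy
in `L²(K)`. -/
theorem exists_subseq_cauchy_setIntegral_sq (hN : 3 ≤ N) (hK : IsCompact K)
    {u : ℕ → EuclideanSpace ℝ (Fin N) → ℝ} (hu : ∀ k, IsTest N Ω (u k)) {A : ℝ}
    (hA : ∀ k, grad2 N (u k) ≤ A) :
    ∃ φ : ℕ → ℕ, StrictMono φ ∧ ∀ ε : ℝ, 0 < ε → ∃ M : ℕ, ∀ j ≥ M, ∀ l ≥ M,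
      ∫ x in K, (u (φ j) x - u (φ l) x) ^ 2 < ε := by
  have hA0 : 0 ≤ A := (grad2_nonneg _).trans (hA 0)
  set K' := Metric.cthickening 1 K with hK'def
  have hK' : IsCompact K' := hK.cthickening
  obtain ⟨C, hC, hCu⟩ := exists_setIntegral_mul_sq_le hN
  obtain ⟨D, hD⟩ : ∃ D, ∀ k, ∫ x in K', u k x ^ 2 ≤ D := by
    refine ⟨C * (∫ x in K', (1 : ℝ) ^ ((N : ℝ) / 2)) ^ (2 / (N : ℝ)) * A, fun k => ?_⟩
    have h := hCu K' (fun _ => 1) (u k) (fun _ => zero_le_one) aestronglyMeasurable_const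
      (by simpa using hK'.measure_lt_top) ((hu k).mono (Set.subset_univ _))
    simp only [one_mul] at h
    refine h.trans (mul_le_mul_of_nonneg_left (hA k) (mul_nonneg hC.le (Real.rpow_nonneg ?_ _)))
    exact integral_nonneg fun x => by positivity
  obtain ⟨φ, hφ, hconv⟩ := exists_subseq_tendsto_setIntegral hK' (fun k => (hu k).continuous) hD
  refine ⟨φ, hφ, fun ε hε => ?_⟩
  obtain ⟨r, hr0, hr1, hrε⟩ : ∃ r : ℝ, 0 < r ∧ r ≤ 1 ∧ 2 * r ^ 2 * (4 * A) < ε / 2 := by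
    have hlim : Tendsto (fun r : ℝ => 2 * r ^ 2 * (4 * A)) (𝓝[>] 0) (𝓝 0) := by
      refine tendsto_nhdsWithin_of_tendsto_nhds ?_
      have : Continuous fun r : ℝ => 2 * r ^ 2 * (4 * A) := by fun_prop
      simpa using this.tendsto 0
    obtain ⟨r, h1, h2, h3⟩ := ((hlim.eventually_lt_const (half_pos hε)).and
      ((eventually_nhdsWithin_of_eventually_nhds (eventually_le_nhds zero_lt_one)).and
        self_mem_nhdsWithin)).exists
    exact ⟨r, h3, h2, h1⟩
  set B := Metric.closedBall (0 : EuclideanSpace ℝ (Fin N)) r with hB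
  have hBc : IsCompact B := isCompact_closedBall _ _
  have hBm : MeasurableSet B := hBc.measurableSet
  set b := volume.real B with hb
  set S : ℕ → EuclideanSpace ℝ (Fin N) → ℝ := fun k x => ∫ y in B, u (φ k) (x + y) with hS
  have hScont : ∀ k, Continuous (S k) := fun k => by
    have := (hu (φ k)).continuous
    exact continuous_parametric_integral_of_continuous
      (by fun_prop : Continuous fun z : EuclideanSpace ℝ (Fin N) × EuclideanSpace ℝ (Fin N) =>
      u (φ k) (z.1 + z.2)) hBc
  have hball : ∀ x ∈ K, Metric.closedBall x r ⊆ K' := fun x hx =>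
    (Metric.closedBall_subset_closedBall hr1).trans (Metric.closedBall_subset_cthickening hx 1)
  have hSeq : ∀ (f : EuclideanSpace ℝ (Fin N) → ℝ) x,
      ∫ y in B, f (x + y) = ∫ y in Metric.closedBall x r, f y := by
    intro f x
    have h := (measurePreserving_add_left
      (volume : Measure (EuclideanSpace ℝ (Fin N))) x).setIntegral_preimage_emb
      (measurableEmbedding_addLeft x) f (Metric.closedBall x r)
    rw [← h]
    congr 2
    simp [hB]
  have hSconv : ∀ x ∈ K, ∃ c, Tendsto (fun k => S k x) atTop (𝓝 c) := by
    intro x hx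
    simp only [hS, hSeq]
    exact hconv _ (hball x hx) Metric.isClosed_closedBall.measurableSet
  have hSbound : ∀ k, ∀ x ∈ K, |S k x| ≤ b + D := by
    intro k x hx
    have hcu := (hu (φ k)).continuous
    have hint : ∀ {f : EuclideanSpace ℝ (Fin N) → ℝ} {s : Set (EuclideanSpace ℝ (Fin N))},
        Continuous f → IsCompact s → IntegrableOn f s :=
      fun hf hs => hf.continuousOn.integrableOn_compact hs
    calc |S k x| ≤ ∫ y in B, |u (φ k) (x + y)| := abs_integral_le_integral_abs
      _ ≤ ∫ y in B, (1 + u (φ k) (x + y) ^ 2) := by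
          refine integral_mono (hint (by fun_prop) hBc) (hint (by fun_prop) hBc) fun y => ?_
          simp only
          rw [← sq_abs (u (φ k) (x + y))]
          nlinarith [sq_nonneg (|u (φ k) (x + y)| - 1), abs_nonneg (u (φ k) (x + y))]
      _ = b + ∫ y in Metric.closedBall x r, u (φ k) y ^ 2 := by
          rw [integral_add (hint (by fun_prop) hBc) (hint (by fun_prop) hBc),
            hSeq (fun y => u (φ k) y ^ 2)]
          simp [hb]
      _ ≤ b + D := by
          refine add_le_add le_rfl (le_trans ?_ (hD (φ k)))
          exact setIntegral_mono_set (hint (by fun_prop) hK') (ae_of_all _ fun y => sq_nonneg _)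
            (hball x hx).eventuallyLE
  have hlim : Tendsto (fun z : ℕ × ℕ => ∫ x in K, (S z.1 x - S z.2 x) ^ 2)
      (atTop ×ˢ atTop) (𝓝 0) := by
    have h0 : (0 : ℝ) = ∫ _x in K, (0 : ℝ) := by simp
    rw [h0]
    refine tendsto_integral_filter_of_dominated_convergence (fun _ => (2 * (b + D)) ^ 2)
      (Eventually.of_forall fun z =>
        (((hScont z.1).sub (hScont z.2)).pow 2).aestronglyMeasurable)
      (Eventually.of_forall fun z => ?_) ?_ ?_
    · filter_upwards [ae_restrict_mem hK.measurableSet] with x hx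
      rw [Real.norm_of_nonneg (sq_nonneg _), ← sq_abs]
      refine pow_le_pow_left₀ (abs_nonneg _) ((abs_sub _ _).trans ?_) 2
      linarith [hSbound z.1 x hx, hSbound z.2 x hx]
    · exact integrable_const_iff.2 (Or.inr ⟨by simpa using hK.measure_lt_top⟩)
    · filter_upwards [ae_restrict_mem hK.measurableSet] with x hx
      obtain ⟨c, hc⟩ := hSconv x hx
      have := ((hc.comp tendsto_fst).sub (hc.comp tendsto_snd)).pow 2
      simpa using this
  have hev := (hlim.const_mul (4 / b ^ 2)).eventually_lt_const
    (by rw [mul_zero]; exact half_pos hε : 4 / b ^ 2 * 0 < ε / 2)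
  rw [prod_atTop_atTop_eq, eventually_atTop_prod_self'] at hev
  obtain ⟨M, hM⟩ := hev
  refine ⟨M, fun j hj l hl => ?_⟩
  have hw := (hu (φ j)).sub (hu (φ l))
  have hgrad : grad2 N (u (φ j) - u (φ l)) ≤ 4 * A := by
    have := grad2_add_add_grad2_sub (hu (φ j)) (hu (φ l))
    linarith [hA (φ j), hA (φ l), grad2_nonneg (u (φ j) + u (φ l))]
  have h1 := hw.setIntegral_sq_le hK hr0
  have hSsub : ∀ x, ∫ y in B, (u (φ j) - u (φ l)) (x + y) = S j x - S l x := by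
    intro x
    have hj := (hu (φ j)).continuous
    have hl := (hu (φ l)).continuous
    exact integral_sub (Continuous.continuousOn (by fun_prop) |>.integrableOn_compact hBc)
      (Continuous.continuousOn (by fun_prop) |>.integrableOn_compact hBc)
  simp only [← hB, hSsub, ← hb] at h1
  have h2 : 2 * r ^ 2 * grad2 N (u (φ j) - u (φ l)) ≤ 2 * r ^ 2 * (4 * A) := by gcongr
  have h3 := hM j hj l hl
  simp only [Pi.sub_apply] at h1 h3
  linarith

end Rellich

/-! ### Minimizing sequences -/

lemma grad2_sub {N : ℕ} {Ω : Set (EuclideanSpace ℝ (Fin N))}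
    {u v : EuclideanSpace ℝ (Fin N) → ℝ} (hu : IsTest N Ω u) (hv : IsTest N Ω v) :
    ∫ x, ‖fderiv ℝ u x - fderiv ℝ v x‖ ^ 2 = grad2 N (u - v) := by
  refine integral_congr_ae (ae_of_all _ fun x => ?_)
  simp only
  rw [fderiv_sub (hu.differentiable x) (hv.differentiable x)]

/-- Minimizing sequences below the threshold `μ_Ω` are relatively compact in the Dirichlet norm. -/
theorem MinimizingSeq.exists_subseq_gradCauchy {N : ℕ} (hN : 3 ≤ N) {p : ℝ}
    (hp : (N : ℝ) / 2 < p) {X Ω B : Set (EuclideanSpace ℝ (Fin N))} (hX : IsOpen X)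
    {V : EuclideanSpace ℝ (Fin N) → ℝ} (hV : ∀ x, 0 ≤ V x) (hVloc : LocLp N p V X)
    (hΩX : Ω ⊆ X) (hB : IsOpen B) (hBk : IsCompact (closure B)) (hBX : closure B ⊆ X)
    (hpos : 0 < mu N V (Ω ∪ B)) (hlt : mu N V (Ω ∪ B) < mu N V Ω)
    {u : ℕ → EuclideanSpace ℝ (Fin N) → ℝ} (hu : MinimizingSeq N V (Ω ∪ B) u) :
    ∃ k : ℕ → ℕ, StrictMono k ∧ GradCauchy N (u ∘ k) := by
  have hp1 : 1 ≤ p := by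
    have : (3 : ℝ) ≤ N := by exact_mod_cast hN
    linarith
  obtain ⟨hu, hven, hlim⟩ := hu
  have hWX : Ω ∪ B ⊆ X := Set.union_subset hΩX (subset_closure.trans hBX)
  obtain ⟨K, C, hK, hC, hmain⟩ :=
    exists_grad2_le hN hp hX hV hVloc hΩX hBk hB hBX hpos hlt
  obtain ⟨A, hA⟩ := hlim.bddAbove_range
  obtain ⟨k, hk, hcauchy⟩ := exists_subseq_cauchy_setIntegral_sq hN hK hu
    fun n => hA (Set.mem_range_self n)
  refine ⟨k, hk, fun ε hε => ?_⟩
  set μ := mu N V (Ω ∪ B) with hμ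
  obtain ⟨M₁, hM₁⟩ := hcauchy (ε / (2 * C)) (by positivity)
  have hδ : μ < μ + ε / (8 * C) := lt_add_of_pos_right _ (by positivity)
  obtain ⟨M₂, hM₂⟩ := eventually_atTop.1
    ((hlim.comp hk.tendsto_atTop).eventually_lt_const hδ)
  refine ⟨max M₁ M₂, fun j hj l hl => ?_⟩
  have hj' := hM₂ j ((le_max_right _ _).trans hj)
  have hl' := hM₂ l ((le_max_right _ _).trans hl)
  have hb := hM₁ j ((le_max_left _ _).trans hj) l ((le_max_left _ _).trans hl)
  simp only [Function.comp_apply] at hj' hl' ⊢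
  have htj := hu (k j)
  have htl := hu (k l)
  rw [grad2_sub htj htl]
  have h1 := grad2_add_add_grad2_sub htj htl
  have h2 := ven_add_add_ven_sub hp1 hV hVloc (htj.mono hWX) (htl.mono hWX)
  have h3 := mu_mul_ven_le hV (htj.add htl)
  have h4 := mu_mul_ven_le hV (htj.sub htl)
  rw [hven, hven] at h2
  rw [← hμ] at h3 h4
  have h5 := hmain _ (htj.sub htl) (sub_nonneg.2 h4)
  have h6 : grad2 N (u (k j) - u (k l)) - μ * ven N V (u (k j) - u (k l)) < ε / (2 * C) := by
    have e : ven N V (u (k j) - u (k l)) = 4 - ven N V (u (k j) + u (k l)) := by linarith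
    have e' : ε / (2 * C) = 4 * (ε / (8 * C)) := by field_simp; norm_num
    rw [e, e']
    linarith
  simp only [Pi.sub_apply] at h5
  calc _ ≤ _ := h5
    _ < C * (ε / (2 * C) + ε / (2 * C)) := by gcongr
    _ = ε := by field_simp; norm_num

/-- **Theorem 1.2 (Pinchover–Tintarev).** If `0 < μ_X < μ_Ω` then there is a relatively
compact open set `B ⋐ X` with `Ω ∪ B` connected and `μ_{Ω∪B} < μ_Ω`; and for any such `B`
the infimum `μ_{Ω∪B}` is attained (every normalized minimizing sequence has a subsequence
whose gradients are Cauchy in `L²`). -/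
theorem existence_of_minimizer_under_compact_domain_perturbation
    (N : ℕ) (hN : 3 ≤ N) (p : ℝ) (hp : (N : ℝ) / 2 < p)
    (X : Set (EuclideanSpace ℝ (Fin N))) (hXop : IsOpen X) (hXconn : IsConnected X)
    (V : EuclideanSpace ℝ (Fin N) → ℝ) (hV0 : ∀ x, 0 ≤ V x) (hVloc : LocLp N p V X)
    (Ω : Set (EuclideanSpace ℝ (Fin N))) (hΩop : IsOpen Ω) (hΩconn : IsConnected Ω)
    (hΩX : Ω ⊆ X)
    (hne : ∃ u₀, IsTest N Ω u₀ ∧ 0 < ven N V u₀)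
    (hmuX : 0 < mu N V X) (hmuΩ : mu N V X < mu N V Ω) :
    (∃ B : Set (EuclideanSpace ℝ (Fin N)), IsOpen B ∧ IsCompact (closure B) ∧
      closure B ⊆ X ∧ IsConnected (Ω ∪ B) ∧ mu N V (Ω ∪ B) < mu N V Ω) ∧
    ∀ B : Set (EuclideanSpace ℝ (Fin N)), IsOpen B → IsCompact (closure B) →
      closure B ⊆ X → IsConnected (Ω ∪ B) → mu N V (Ω ∪ B) < mu N V Ω →
      ∀ u : ℕ → EuclideanSpace ℝ (Fin N) → ℝ, MinimizingSeq N V (Ω ∪ B) u →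
        ∃ k : ℕ → ℕ, StrictMono k ∧ GradCauchy N (u ∘ k) := by
  refine ⟨exists_perturbation_mu_lt hXop hXconn hΩconn hΩX hne hmuΩ,
    fun B hB hBk hBX _ hlt u hu => ?_⟩
  have hpos : 0 < mu N V (Ω ∪ B) := by
    obtain ⟨u₀, hu₀, h₀⟩ := hne
    exact hmuX.trans_le (mu_anti ⟨u₀, hu₀.mono Set.subset_union_left, h₀⟩
      (Set.union_subset hΩX (subset_closure.trans hBX)))
  exact hu.exists_subseq_gradCauchy hN hp hXop hV0 hVloc hΩX hB hBk hBX hpos hlt
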